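/- Let m ≥ 1 be an integer and u, ω be smooth zero-mean functions on S¹ with u_x = H(ω). Then there exists C(m) > 0 such that |⟨∂ₓω, uω⟩_{Ḣ^m}| ≤ C(m) ‖ω‖_{Ḣ^{m+1}}^{2 − 1/(2(m+1))} ‖ω‖_{L²}^{1 + 1/(2(m+1))}. -/

import Mathlib

/-- Orthonormal basis of zero-mean `L²(S¹)`. -/
noncomputable def ebasis (k : ℤ) (x : ℝ) : ℝ :=
  if 1 ≤ k then Real.cos ((k : ℝ) * x) / Real.sqrt Real.pi
  else Real.sin (-(k : ℝ) * x) / Real.sqrt Real.pi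

/-- Fourier coefficient `⟨f, e_k⟩`. -/
noncomputable def fc (f : ℝ → ℝ) (k : ℤ) : ℝ :=
  ∫ x in (0 : ℝ)..(2 * Real.pi), f x * ebasis k x

/-- Homogeneous Sobolev norm `‖f‖_{Ḣ^s}`. -/
noncomputable def sobNorm (s : ℝ) (f : ℝ → ℝ) : ℝ :=
  Real.sqrt (∑' k : ℤ, (|k| : ℝ) ^ (2 * s) * (fc f k) ^ 2)

/-- Homogeneous Sobolev inner product `⟨f, g⟩_{Ḣ^s} = Σ_{k≠0}|k|^{2s} f̂(k)ĝ(k)`. -/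
noncomputable def sobIP (s : ℝ) (f g : ℝ → ℝ) : ℝ :=
  ∑' k : ℤ, (|k| : ℝ) ^ (2 * s) * fc f k * fc g k

/-- `L²(S¹)` norm. -/
noncomputable def l2norm (f : ℝ → ℝ) : ℝ :=
  Real.sqrt (∫ x in (0 : ℝ)..(2 * Real.pi), f x * f x)

/-- `g = H(ω)` on Fourier modes. -/
def IsHilbertPair (ω g : ℝ → ℝ) : Prop :=
  ∀ k : ℤ, 1 ≤ k → fc g k = - fc ω (-k) ∧ fc g (-k) = fc ω k

open Real MeasureTheory intervalIntegral

lemma fc_zero (f : ℝ → ℝ) : fc f 0 = 0 := by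
  simp [fc, ebasis]

lemma fc_pos (f : ℝ → ℝ) (k : ℤ) (hk : 1 ≤ k) :
    fc f k = (∫ x in (0 : ℝ)..(2 * π), f x * cos (k * x)) / √π := by
  simp only [fc, ebasis, if_pos hk, ← mul_div_assoc]
  rw [intervalIntegral.integral_div]

lemma fc_neg (f : ℝ → ℝ) (k : ℤ) (hk : ¬ 1 ≤ k) :
    fc f k = -(∫ x in (0 : ℝ)..(2 * π), f x * sin (k * x)) / √π := by
  simp only [fc, ebasis, if_neg hk, ← mul_div_assoc]
  rw [intervalIntegral.integral_div, ← intervalIntegral.integral_neg]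
  simp

lemma fc_sq_add (f : ℝ → ℝ) (h0 : (∫ x in (0 : ℝ)..(2 * π), f x) = 0) (k : ℤ) :
    (∫ x in (0 : ℝ)..(2 * π), f x * cos (k * x)) ^ 2
      + (∫ x in (0 : ℝ)..(2 * π), f x * sin (k * x)) ^ 2
      = π * (fc f k ^ 2 + fc f (-k) ^ 2) := by
  have hp : (√π) ^ 2 = π := Real.sq_sqrt pi_pos.le
  have hp0 : π ≠ 0 := pi_ne_zero
  rcases lt_trichotomy k 0 with h | h | h
  · rw [fc_neg f k (by omega), fc_pos f (-k) (by omega)]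
    simp only [div_pow, hp]
    field_simp
    simp
    ring
  · subst h
    simp [fc_zero, h0]
  · rw [fc_pos f k (by omega), fc_neg f (-k) (by omega)]
    simp only [div_pow, hp]
    field_simp
    simp

lemma coeff_norm_sq (f : ℝ → ℝ) (hf : Continuous f) (k : ℤ) :
    ‖fourierCoeffOn (show (0:ℝ) < 2 * π by positivity) (fun x => (f x : ℂ)) k‖ ^ 2
    = (1 / (2 * π)) ^ 2 * ((∫ x in (0 : ℝ)..(2 * π), f x * cos (k * x)) ^ 2
      + (∫ x in (0 : ℝ)..(2 * π), f x * sin (k * x)) ^ 2) := by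
  rw [fourierCoeffOn_eq_integral, norm_smul, mul_pow]
  have e : (∫ x in (0 : ℝ)..(2 * π), fourier (-k) (x : AddCircle (2 * π - 0)) • (f x : ℂ))
      = (((∫ x in (0 : ℝ)..(2 * π), f x * cos (k * x)) : ℝ) : ℂ)
        + (((-∫ x in (0 : ℝ)..(2 * π), f x * sin (k * x)) : ℝ) : ℂ) * Complex.I := by
    rw [← intervalIntegral.integral_neg, ← intervalIntegral.integral_ofReal,
      ← intervalIntegral.integral_ofReal, ← intervalIntegral.integral_mul_const,
      ← intervalIntegral.integral_add]
    · apply intervalIntegral.integral_congr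
      intro x _
      simp only [fourier_coe_apply, smul_eq_mul]
      have : 2 * (π:ℂ) * Complex.I * ((-k : ℤ) : ℂ) * x / ((2 * π - 0 : ℝ) : ℂ)
          = ((-(k * x) : ℝ) : ℂ) * Complex.I := by
        have : (π : ℂ) ≠ 0 := by exact_mod_cast pi_ne_zero
        push_cast
        field_simp
        ring
      rw [this, Complex.exp_mul_I, ← Complex.ofReal_cos, ← Complex.ofReal_sin, Real.cos_neg,
        Real.sin_neg]
      push_cast
      ring
    · apply Continuous.intervalIntegrable
      fun_prop
    · apply Continuous.intervalIntegrable
      fun_prop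
  rw [e, Complex.sq_norm, Complex.normSq_add_mul_I]
  simp [abs_of_pos pi_pos]

lemma parseval (f : ℝ → ℝ) (hf : Continuous f) (h0 : (∫ x in (0 : ℝ)..(2 * π), f x) = 0) :
    HasSum (fun k : ℤ => fc f k ^ 2) (∫ x in (0 : ℝ)..(2 * π), f x * f x) := by
  have hm : MemLp (fun x => (f x : ℂ)) 2 (volume.restrict (Set.Ioc (0:ℝ) (2 * π))) := by
    have h1 : Continuous (fun x => (f x : ℂ)) := by fun_prop
    obtain ⟨C, hC⟩ := (isCompact_Icc (a := (0:ℝ)) (b := 2 * π)).exists_bound_of_continuousOn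
      h1.continuousOn
    refine MemLp.of_bound h1.aestronglyMeasurable C ?_
    filter_upwards [ae_restrict_mem measurableSet_Ioc] with x hx
    exact hC x (Set.Ioc_subset_Icc_self hx)
  have h := hasSum_sq_fourierCoeffOn (show (0:ℝ) < 2 * π by positivity) hm
  simp only [coeff_norm_sq f hf, fc_sq_add f h0] at h
  have h2 := h.mul_left (4 * π)
  have hp0 : π ≠ 0 := pi_ne_zero
  have h3 : HasSum (fun k : ℤ => fc f k ^ 2 + fc f (-k) ^ 2)
      (2 * ∫ x in (0 : ℝ)..(2 * π), f x * f x) := by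
    have e1 : (fun k : ℤ => fc f k ^ 2 + fc f (-k) ^ 2)
        = fun i : ℤ => 4 * π * ((1 / (2 * π)) ^ 2 * (π * (fc f i ^ 2 + fc f (-i) ^ 2))) := by
      ext k; field_simp; norm_num
    have e2 : 2 * ∫ x in (0 : ℝ)..(2 * π), f x * f x
        = 4 * π * (2 * π - 0)⁻¹ • ∫ x in (0 : ℝ)..(2 * π), ‖(f x : ℂ)‖ ^ 2 := by
      simp only [Complex.norm_real, norm_eq_abs, smul_eq_mul, sq, sub_zero]
      field_simp
      norm_num
    rw [e1, e2]
    exact h2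
  have hs : Summable (fun k : ℤ => fc f k ^ 2) :=
    Summable.of_nonneg_of_le (fun k => by positivity) (fun k => by nlinarith [sq_nonneg (fc f (-k))])
      h3.summable
  have h4 := hs.hasSum
  have h5 : HasSum (fun k : ℤ => fc f (-k) ^ 2) (∑' k : ℤ, fc f k ^ 2) :=
    (Equiv.neg ℤ).hasSum_iff (f := fun k : ℤ => fc f k ^ 2) |>.2 h4
  have := (h4.add h5).unique h3
  have e : (∑' k : ℤ, fc f k ^ 2) = ∫ x in (0 : ℝ)..(2 * π), f x * f x := by linarith
  rwa [e] at h4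

lemma fc_deriv (f : ℝ → ℝ) (hf : ContDiff ℝ (⊤ : ℕ∞) f) (hp : Function.Periodic f (2 * π))
    (k : ℤ) : fc (deriv f) k = k * fc f (-k) := by
  have hd : ∀ x, HasDerivAt f (deriv f x) x := fun x =>
    ((hf.differentiable (by simp)) x).hasDerivAt
  have hc : Continuous (deriv f) := hf.continuous_deriv (by simp)
  have hf2 : f (2 * π) = f 0 := by simpa using hp 0
  have hcos : ∀ k : ℤ, (∫ x in (0 : ℝ)..(2 * π), deriv f x * cos (k * x))
      = k * ∫ x in (0 : ℝ)..(2 * π), f x * sin (k * x) := by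
    intro k
    have := intervalIntegral.integral_deriv_mul_eq_sub (a := 0) (b := 2 * π)
      (u := f) (v := fun x => cos (k * x)) (u' := deriv f) (v' := fun x => -sin (k * x) * k)
      (fun x _ => hd x) (fun x _ => by
        simpa using (((hasDerivAt_id x).const_mul (k:ℝ)).cos))
      (hc.intervalIntegrable _ _) (Continuous.intervalIntegrable (by fun_prop) _ _)
    rw [intervalIntegral.integral_add (Continuous.intervalIntegrable (by fun_prop) _ _)
      (Continuous.intervalIntegrable (by have := hf.continuous; fun_prop) _ _)] at this
    have e : cos (k * (2 * π)) = 1 := by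
      exact_mod_cast Real.cos_int_mul_two_pi k
    rw [hf2, e] at this
    simp only [mul_zero, cos_zero, sub_self] at this
    have e2 : (∫ x in (0 : ℝ)..(2 * π), f x * (-sin (k * x) * k))
        = - (k * ∫ x in (0 : ℝ)..(2 * π), f x * sin (k * x)) := by
      rw [← intervalIntegral.integral_const_mul, ← intervalIntegral.integral_neg]
      congr 1; ext x; ring
    linarith
  have hsin : ∀ k : ℤ, (∫ x in (0 : ℝ)..(2 * π), deriv f x * sin (k * x))
      = - (k * ∫ x in (0 : ℝ)..(2 * π), f x * cos (k * x)) := by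
    intro k
    have := intervalIntegral.integral_deriv_mul_eq_sub (a := 0) (b := 2 * π)
      (u := f) (v := fun x => sin (k * x)) (u' := deriv f) (v' := fun x => cos (k * x) * k)
      (fun x _ => hd x) (fun x _ => by
        simpa using (((hasDerivAt_id x).const_mul (k:ℝ)).sin))
      (hc.intervalIntegrable _ _) (Continuous.intervalIntegrable (by fun_prop) _ _)
    rw [intervalIntegral.integral_add (Continuous.intervalIntegrable (by fun_prop) _ _)
      (Continuous.intervalIntegrable (by have := hf.continuous; fun_prop) _ _)] at this
    have e : sin (k * (2 * π)) = 0 := by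
      have := Real.sin_int_mul_pi (2 * k)
      push_cast at this
      rw [← this]; ring_nf
    rw [e] at this
    simp only [mul_zero, sin_zero, sub_self] at this
    have e2 : (∫ x in (0 : ℝ)..(2 * π), f x * (cos (k * x) * k))
        = (k * ∫ x in (0 : ℝ)..(2 * π), f x * cos (k * x)) := by
      rw [← intervalIntegral.integral_const_mul]
      congr 1; ext x; ring
    linarith
  rcases lt_trichotomy k 0 with h | h | h
  · rw [fc_neg _ k (by omega), fc_pos f (-k) (by omega), hsin]
    simp [mul_div_assoc]
  · subst h; simp [fc_zero]
  · rw [fc_pos _ k (by omega), fc_neg f (-k) (by omega), hcos]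
    simp [mul_div_assoc]

lemma integral_deriv_zero (f : ℝ → ℝ) (hf : ContDiff ℝ (⊤ : ℕ∞) f)
    (hp : Function.Periodic f (2 * π)) : (∫ x in (0 : ℝ)..(2 * π), deriv f x) = 0 := by
  rw [intervalIntegral.integral_deriv_eq_sub (fun x _ => (hf.differentiable (by simp)) x)
    ((hf.continuous_deriv (by simp)).intervalIntegrable _ _)]
  have hf2 : f (2 * π) = f 0 := by simpa using hp 0
  simp [hf2]

/-- smooth periodic -/
def SP (f : ℝ → ℝ) : Prop := ContDiff ℝ (⊤ : ℕ∞) f ∧ Function.Periodic f (2 * π)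

lemma SP.deriv {f : ℝ → ℝ} (hf : SP f) : SP (deriv f) := by
  refine ⟨(contDiff_infty_iff_deriv.1 hf.1).2, fun x => ?_⟩
  rw [← deriv_comp_add_const]
  congr 1
  exact funext hf.2

lemma SP.iter {f : ℝ → ℝ} (hf : SP f) (n : ℕ) : SP (iteratedDeriv n f) := by
  induction n with
  | zero => simpa using hf
  | succ n ih => rw [iteratedDeriv_succ]; exact ih.deriv

lemma SP.mean_iter {f : ℝ → ℝ} (hf : SP f) (n : ℕ) (hn : n = 0 → (∫ x in (0 : ℝ)..(2 * π), f x) = 0) :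
    (∫ x in (0 : ℝ)..(2 * π), iteratedDeriv n f x) = 0 := by
  cases n with
  | zero => simpa using hn rfl
  | succ n => rw [iteratedDeriv_succ]; exact integral_deriv_zero _ (hf.iter n).1 (hf.iter n).2

lemma fc_iter_sq {f : ℝ → ℝ} (hf : SP f) (n : ℕ) :
    (∀ k, fc (iteratedDeriv n f) k ^ 2 = (k ^ 2 : ℝ) ^ n * fc f k ^ 2) ∨
    (∀ k, fc (iteratedDeriv n f) k ^ 2 = (k ^ 2 : ℝ) ^ n * fc f (-k) ^ 2) := by
  induction n with
  | zero => left; simp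
  | succ n ih =>
    rcases ih with ih | ih
    · right; intro k
      rw [iteratedDeriv_succ, fc_deriv _ (hf.iter n).1 (hf.iter n).2, mul_pow, ih]
      push_cast; ring
    · left; intro k
      rw [iteratedDeriv_succ, fc_deriv _ (hf.iter n).1 (hf.iter n).2, mul_pow, ih]
      push_cast; ring_nf

lemma abs_rpow_two (k : ℤ) (n : ℕ) : (|k| : ℝ) ^ (2 * (n : ℝ)) = (k ^ 2 : ℝ) ^ n := by
  rw [Real.rpow_mul (abs_nonneg _), Real.rpow_natCast]
  norm_num

/-- square of the L2 norm of the n-th derivative -/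
noncomputable def E (n : ℕ) (f : ℝ → ℝ) : ℝ :=
  ∫ x in (0 : ℝ)..(2 * π), iteratedDeriv n f x * iteratedDeriv n f x

lemma hasSum_E {f : ℝ → ℝ} (hf : SP f) (n : ℕ) (hn : n = 0 → (∫ x in (0 : ℝ)..(2 * π), f x) = 0) :
    HasSum (fun k : ℤ => (k ^ 2 : ℝ) ^ n * fc f k ^ 2) (E n f) := by
  unfold E
  have h := parseval _ (hf.iter n).1.continuous (hf.mean_iter n hn)
  rcases fc_iter_sq hf n with H | H
  · simpa only [H] using h
  · simp only [H] at h
    have := (Equiv.neg ℤ).hasSum_iff.2 h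
    simpa [Function.comp_def] using this

lemma E_nonneg (n : ℕ) (f : ℝ → ℝ) : 0 ≤ E n f :=
  intervalIntegral.integral_nonneg (by positivity) (fun x _ => mul_self_nonneg _)

lemma sobNorm_eq {f : ℝ → ℝ} (hf : SP f) (n : ℕ)
    (hn : n = 0 → (∫ x in (0 : ℝ)..(2 * π), f x) = 0) : sobNorm n f = √(E n f) := by
  simp only [sobNorm, abs_rpow_two]
  rw [(hasSum_E hf n hn).tsum_eq]

lemma E_hilbert {u ω : ℝ → ℝ} (hu : SP u) (hω : SP ω) (h0u : (∫ x in (0 : ℝ)..(2 * π), u x) = 0)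
    (h0 : (∫ x in (0 : ℝ)..(2 * π), ω x) = 0) (H : IsHilbertPair ω (deriv u)) (n : ℕ) :
    E n u ≤ E n ω := by
  have h1 := hasSum_E hu n (fun _ => h0u)
  have h2 := hasSum_E hω n (fun _ => h0)
  refine hasSum_le (fun k => ?_) h1 h2
  have e : (fc (deriv u) (-k)) ^ 2 = fc ω k ^ 2 := by
    rcases lt_trichotomy k 0 with h | h | h
    · have := (H (-k) (by omega)).1
      simp only [neg_neg] at this
      rw [this]; ring
    · subst h; simp [fc_zero]
    · rw [(H k (by omega)).2]
  rw [fc_deriv u hu.1 hu.2, neg_neg] at e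
  push_cast at e
  refine mul_le_mul_of_nonneg_left ?_ (by positivity)
  rw [← e]
  by_cases hk : k = 0
  · subst hk; simp [fc_zero]
  · have : (1:ℝ) ≤ (k:ℝ) ^ 2 := by
      have : 1 ≤ k ^ 2 := by have := sq_nonneg k; have : k ^ 2 ≠ 0 := by positivity
                             omega
      exact_mod_cast this
    nlinarith [sq_nonneg (fc u k)]
lemma sq_le_of_quad {P S Q : ℝ} (h : ∀ t : ℝ, 0 ≤ P * (t * t) + (2 * S) * t + Q) :
    |S| ≤ √P * √Q := by
  have h1 := discrim_le_zero h
  have hP : 0 ≤ P := by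
    by_contra hP
    push Not at hP
    rw [discrim] at h1
    have h0 := h 0
    have h2 := h 1
    have h3 := h (-1)
    have : 0 ≤ Q := by simpa using h0
    obtain ⟨t, ht⟩ : ∃ t : ℝ, 1 ≤ t ∧ P * (t * t) + Q < 0 := by
      refine ⟨Q / (-P) + 1, ?_, ?_⟩
      · have : 0 ≤ Q / (-P) := div_nonneg this (by linarith)
        linarith
      · have h5 : 0 ≤ Q / (-P) := div_nonneg this (by linarith)
        have h6 : Q = (Q / (-P)) * (-P) := (div_mul_cancel₀ Q (by linarith)).symm
        nlinarith [mul_nonneg h5 h5]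
    have h4 := h t
    have h5 := h (-t)
    nlinarith
  rw [← Real.sqrt_mul hP]
  apply Real.abs_le_sqrt
  rw [discrim] at h1
  nlinarith

lemma cs_tsum {p q : ℤ → ℝ} {P Q : ℝ} (hp : HasSum (fun k => p k ^ 2) P)
    (hq : HasSum (fun k => q k ^ 2) Q) : |∑' k, p k * q k| ≤ √P * √Q := by
  have hs : Summable (fun k => p k * q k) := by
    refine Summable.of_norm_bounded (hp.summable.add hq.summable) (fun k => ?_)
    rw [norm_eq_abs, abs_le]
    constructor <;> nlinarith [sq_nonneg (p k + q k), sq_nonneg (p k - q k),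
      sq_nonneg (p k), sq_nonneg (q k)]
  apply sq_le_of_quad
  intro t
  have := ((hp.mul_left (t * t)).add (hs.hasSum.mul_left (2 * t))).add hq
  have h0 := this.nonneg (fun k => by nlinarith [sq_nonneg (t * p k + q k)])
  nlinarith

lemma cs_int {f g : ℝ → ℝ} (hf : Continuous f) (hg : Continuous g) :
    |∫ x in (0 : ℝ)..(2 * π), f x * g x| ≤ √(∫ x in (0 : ℝ)..(2 * π), f x * f x)
      * √(∫ x in (0 : ℝ)..(2 * π), g x * g x) := by
  apply sq_le_of_quad
  intro t
  have h : 0 ≤ ∫ x in (0 : ℝ)..(2 * π), (t * f x + g x) * (t * f x + g x) :=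
    intervalIntegral.integral_nonneg (by positivity) (fun x _ => mul_self_nonneg _)
  have e : (∫ x in (0 : ℝ)..(2 * π), (t * f x + g x) * (t * f x + g x))
      = ∫ x in (0 : ℝ)..(2 * π), ((t * t) * (f x * f x) + (2 * t) * (f x * g x) + g x * g x) := by
    congr 1; ext x; ring
  rw [e, intervalIntegral.integral_add (Continuous.intervalIntegrable (by fun_prop) _ _)
      (Continuous.intervalIntegrable (by fun_prop) _ _),
    intervalIntegral.integral_add (Continuous.intervalIntegrable (by fun_prop) _ _)
      (Continuous.intervalIntegrable (by fun_prop) _ _),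
    intervalIntegral.integral_const_mul, intervalIntegral.integral_const_mul] at h
  linarith

lemma sup_bound {f : ℝ → ℝ} (hf : SP f) (h0 : (∫ x in (0 : ℝ)..(2 * π), f x) = 0)
    {x : ℝ} (hx : x ∈ Set.Icc (0:ℝ) (2 * π)) :
    f x ^ 2 ≤ 2 * (√(∫ x in (0 : ℝ)..(2 * π), f x * f x)
      * √(∫ x in (0 : ℝ)..(2 * π), deriv f x * deriv f x)) := by
  have hc := hf.1.continuous
  have hc' := hf.deriv.1.continuous
  have hd : ∀ x, HasDerivAt f (deriv f x) x := fun x =>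
    ((hf.1.differentiable (by simp)) x).hasDerivAt
  obtain ⟨c, hc1, hc2⟩ := exists_hasDerivAt_eq_zero (f := fun y => ∫ t in (0:ℝ)..y, f t) (f' := f)
    (show (0:ℝ) < 2 * π by positivity)
    (by
      apply Continuous.continuousOn
      exact intervalIntegral.continuous_primitive (fun a b => hc.intervalIntegrable _ _) 0)
    (by simp [h0])
    (fun y _ => hc.integral_hasStrictDerivAt 0 y |>.hasDerivAt)
  have e : (∫ t in c..x, 2 * (f t * deriv f t)) = f x ^ 2 - f c ^ 2 := by
    refine intervalIntegral.integral_eq_sub_of_hasDerivAt (f := fun t => f t ^ 2)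
      (fun t _ => ?_) (Continuous.intervalIntegrable (by fun_prop) _ _)
    have := (hd t).fun_pow 2
    simpa [mul_assoc] using this
  have e2 : f x ^ 2 = ∫ t in c..x, 2 * (f t * deriv f t) := by rw [e, hc2]; ring
  have h1 : f x ^ 2 ≤ ∫ t in (0:ℝ)..(2 * π), |2 * (f t * deriv f t)| := by
    rw [e2]
    refine (Real.le_norm_self _).trans ((intervalIntegral.norm_integral_le_integral_norm_uIoc).trans ?_)
    rw [intervalIntegral.integral_of_le (by positivity : (0:ℝ) ≤ 2 * π)]
    apply setIntegral_mono_set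
    · exact (Continuous.intervalIntegrable (by fun_prop) 0 (2 * π)).1
    · exact Filter.Eventually.of_forall (fun t => abs_nonneg _)
    · refine HasSubset.Subset.eventuallyLE (fun t ht => ?_)
      rw [Set.uIoc, Set.mem_Ioc] at ht
      exact ⟨lt_of_le_of_lt (le_min hc1.1.le hx.1) ht.1, ht.2.trans (max_le hc1.2.le hx.2)⟩
  refine h1.trans ?_
  have h2 := cs_int hc.abs hc'.abs
  simp only [abs_mul_abs_self, ← abs_mul] at h2
  simp only [abs_mul (2:ℝ), intervalIntegral.integral_const_mul]
  simp only [abs_two]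
  have := (le_abs_self _).trans h2
  linarith

lemma E_logconvex {f : ℝ → ℝ} (hf : SP f) (n : ℕ) :
    E (n + 1) f ^ 2 ≤ E n f * E (n + 2) f := by
  have hg := hf.iter n
  have hg1 := hf.iter (n + 1)
  have hg2 := hf.iter (n + 2)
  have hd : ∀ n x, HasDerivAt (iteratedDeriv n f) (iteratedDeriv (n + 1) f x) x := fun n x => by
    rw [iteratedDeriv_succ]
    exact (((hf.iter n).1.differentiable (by simp)) x).hasDerivAt
  have c0 := hg.1.continuous
  have c1 := hg1.1.continuous
  have c2 := hg2.1.continuous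
  have h := intervalIntegral.integral_deriv_mul_eq_sub (a := 0) (b := 2 * π)
    (fun x _ => hd n x) (fun x _ => hd (n + 1) x)
    (c1.intervalIntegrable _ _) (c2.intervalIntegrable _ _)
  have p0 : iteratedDeriv n f (2 * π) = iteratedDeriv n f 0 := by simpa using hg.2 0
  have p1 : iteratedDeriv (n + 1) f (2 * π) = iteratedDeriv (n + 1) f 0 := by simpa using hg1.2 0
  rw [p0, p1, sub_self, intervalIntegral.integral_add
    (Continuous.intervalIntegrable (by fun_prop) _ _)
    (Continuous.intervalIntegrable (by fun_prop) _ _)] at h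
  have hcs := cs_int c0 c2
  have e : E (n + 1) f = - ∫ x in (0 : ℝ)..(2 * π), iteratedDeriv n f x * iteratedDeriv (n + 2) f x := by
    unfold E
    linarith
  rw [e, neg_sq, ← sq_abs]
  have := pow_le_pow_left₀ (abs_nonneg _) hcs 2
  rw [mul_pow] at this
  have q0 := Real.sq_sqrt (E_nonneg n f)
  have q2 := Real.sq_sqrt (E_nonneg (n + 2) f)
  unfold E at q0 q2 ⊢
  rwa [q0, q2] at this

lemma seq_step {a : ℕ → ℝ} (ha : ∀ n, 0 ≤ a n) (h : ∀ n, a (n + 1) ^ 2 ≤ a n * a (n + 2)) (n : ℕ) :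
    a n ^ (n + 1) ≤ a 0 * a (n + 1) ^ n := by
  induction n with
  | zero => simp
  | succ n ih =>
    rcases (ha (n + 1)).eq_or_lt with h0 | h0
    · rw [← h0]
      have := ha 0
      have := ha (n + 1 + 1)
      simp only [ne_eq, Nat.add_eq_zero_iff, one_ne_zero, and_false, not_false_eq_true, zero_pow]
      positivity
    · have h1 := pow_le_pow_left₀ (by positivity) (h n) (n + 1)
      have h2 : a n ^ (n + 1) * a (n + 2) ^ (n + 1) ≤ a 0 * a (n + 1) ^ n * a (n + 2) ^ (n + 1) :=
        mul_le_mul_of_nonneg_right ih (pow_nonneg (ha _) _)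
      rw [mul_pow] at h1
      have h3 := h1.trans h2
      have h4 : 0 < a (n + 1) ^ n := by positivity
      refine le_of_mul_le_mul_left ?_ h4
      calc a (n + 1) ^ n * a (n + 1) ^ (n + 1 + 1) = (a (n + 1) ^ 2) ^ (n + 1) := by ring
        _ ≤ _ := h3
        _ = _ := by ring

lemma seq_interp {a : ℕ → ℝ} (ha : ∀ n, 0 ≤ a n) (h : ∀ n, a (n + 1) ^ 2 ≤ a n * a (n + 2))
    (N : ℕ) (hN : 0 < N) (d j : ℕ) (hj : j + d = N) :
    a j ≤ a 0 ^ (1 - (j : ℝ) / N) * a N ^ ((j : ℝ) / N) := by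
  induction d generalizing j with
  | zero =>
    have : (N : ℝ) ≠ 0 := by positivity
    simp at hj; subst hj
    simp [this]
  | succ d ih =>
    have ih := ih (j + 1) (by omega)
    have hs := seq_step ha h j
    have hN' : (0:ℝ) < N := by positivity
    have hj1 : (0:ℝ) < (j:ℝ) + 1 := by positivity
    have hjN : ((j:ℝ) + 1) / N ≤ 1 := by
      rw [div_le_one hN']; exact_mod_cast (by omega : j + 1 ≤ N)
    push_cast at ih
    have h1 : a j ≤ a 0 ^ (1 / ((j:ℝ) + 1)) * a (j + 1) ^ ((j:ℝ) / (j + 1)) := by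
      have := Real.rpow_le_rpow (by have := ha j; positivity) hs (show 0 ≤ 1 / ((j:ℝ) + 1) by positivity)
      rw [Real.mul_rpow (ha 0) (pow_nonneg (ha _) _), ← Real.rpow_natCast, ← Real.rpow_natCast,
        ← Real.rpow_mul (ha _), ← Real.rpow_mul (ha _)] at this
      have e1 : (((j + 1 : ℕ) : ℝ)) * (1 / ((j:ℝ) + 1)) = 1 := by push_cast; field_simp
      rw [e1, Real.rpow_one] at this
      convert this using 3
      field_simp
    refine h1.trans ?_
    have h2 := Real.rpow_le_rpow (ha (j + 1)) ih (show 0 ≤ (j:ℝ) / (j + 1) by positivity)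
    rw [Real.mul_rpow (Real.rpow_nonneg (ha _) _) (Real.rpow_nonneg (ha _) _),
      ← Real.rpow_mul (ha _), ← Real.rpow_mul (ha _)] at h2
    refine (mul_le_mul_of_nonneg_left h2 (Real.rpow_nonneg (ha 0) _)).trans (le_of_eq ?_)
    rw [← mul_assoc, ← Real.rpow_add_of_nonneg (ha 0) (by positivity)
      (mul_nonneg (by linarith) (by positivity))]
    congr 2
    · field_simp; ring
    · field_simp

lemma E_interp {f : ℝ → ℝ} (hf : SP f) (N : ℕ) (hN : 0 < N) (j : ℕ) (hj : j ≤ N) :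
    E j f ≤ E 0 f ^ (1 - (j : ℝ) / N) * E N f ^ ((j : ℝ) / N) :=
  seq_interp (a := fun n => E n f) (fun n => E_nonneg n f) (E_logconvex hf) N hN (N - j) j (by omega)

/-- one Leibniz term -/
lemma term_bound {ω : ℝ → ℝ} (hω : SP ω) (m k : ℕ) (hk : k ≤ m) :
    √(E k ω) * √(E (k + 1) ω) * E (m - k) ω ≤
      E 0 ω ^ (1 + 1 / (2 * ((m : ℝ) + 1))) * E (m + 1) ω ^ (1 - 1 / (2 * ((m : ℝ) + 1))) := by
  have i1 := E_interp hω (m + 1) (by omega) k (by omega)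
  have i2 := E_interp hω (m + 1) (by omega) (k + 1) (by omega)
  have i3 := E_interp hω (m + 1) (by omega) (m - k) (by omega)
  have x0 := E_nonneg 0 ω
  have y0 := E_nonneg (m + 1) ω
  set x := E 0 ω
  set y := E (m + 1) ω
  have hkm : (k : ℝ) ≤ m := by exact_mod_cast hk
  have hm1 : (0:ℝ) < (m:ℝ) + 1 := by positivity
  rw [Nat.cast_sub hk] at i3
  push_cast at i1 i2 i3
  have s1 := Real.sqrt_le_sqrt i1
  have s2 := Real.sqrt_le_sqrt i2
  rw [Real.sqrt_eq_rpow, Real.sqrt_eq_rpow, Real.mul_rpow (by positivity) (by positivity), ← Real.rpow_mul x0,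
    ← Real.rpow_mul y0] at s1 s2
  rw [Real.sqrt_eq_rpow, Real.sqrt_eq_rpow]
  have d1 : (k:ℝ) / (m + 1) ≤ 1 := by rw [div_le_one hm1]; linarith
  have d2 : ((k:ℝ) + 1) / (m + 1) ≤ 1 := by rw [div_le_one hm1]; linarith
  have d3 : ((m:ℝ) - k) / (m + 1) ≤ 1 := by
    rw [div_le_one hm1]; have : (0:ℝ) ≤ k := by positivity
    linarith
  have d4 : 0 ≤ ((m:ℝ) - k) / (m + 1) := div_nonneg (by linarith) hm1.le
  refine (mul_le_mul (mul_le_mul s1 s2 (Real.rpow_nonneg (E_nonneg _ _) _) (by positivity)) i3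
    (E_nonneg _ _) (by positivity)).trans (le_of_eq ?_)
  rw [show ∀ a b c d e f : ℝ, a * b * (c * d) * (e * f) = (a * c * e) * (b * d * f) by intros; ring]
  rw [← Real.rpow_add_of_nonneg x0, ← Real.rpow_add_of_nonneg x0, ← Real.rpow_add_of_nonneg y0,
    ← Real.rpow_add_of_nonneg y0]
  · congr 2 <;> (field_simp; ring)
  all_goals positivity

lemma prod_bound {u ω : ℝ → ℝ} (hu : SP u) (hω : SP ω) (h0u : (∫ x in (0 : ℝ)..(2 * π), u x) = 0)
    (h0 : (∫ x in (0 : ℝ)..(2 * π), ω x) = 0) (H : IsHilbertPair ω (deriv u)) (m : ℕ) :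
    E m (fun x => u x * ω x) ≤ (((m:ℝ) + 1) * ∑ k ∈ Finset.range (m + 1), (m.choose k : ℝ) ^ 2 * 2) *
      (E 0 ω ^ (1 + 1 / (2 * ((m : ℝ) + 1))) * E (m + 1) ω ^ (1 - 1 / (2 * ((m : ℝ) + 1)))) := by
  set R := E 0 ω ^ (1 + 1 / (2 * ((m : ℝ) + 1))) * E (m + 1) ω ^ (1 - 1 / (2 * ((m : ℝ) + 1)))
  have cu := fun n => (hu.iter n).1.continuous
  have cw := fun n => (hω.iter n).1.continuous
  have hpt : ∀ x ∈ Set.Icc (0:ℝ) (2 * π),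
      iteratedDeriv m (fun x => u x * ω x) x * iteratedDeriv m (fun x => u x * ω x) x
      ≤ ((m:ℝ) + 1) * ∑ k ∈ Finset.range (m + 1), (m.choose k : ℝ) ^ 2 *
        (2 * (√(E k ω) * √(E (k + 1) ω)) * (iteratedDeriv (m - k) ω x * iteratedDeriv (m - k) ω x)) := by
    intro x hx
    rw [iteratedDeriv_fun_mul (hu.1.contDiffAt.of_le (by exact_mod_cast le_top))
      (hω.1.contDiffAt.of_le (by exact_mod_cast le_top)), ← sq]
    refine (sq_sum_le_card_mul_sum_sq).trans ?_
    rw [Finset.card_range]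
    push_cast
    gcongr with k hk
    have h1 := sup_bound (hu.iter k) (hu.mean_iter k (fun _ => h0u)) hx
    rw [← iteratedDeriv_succ] at h1
    have h2 : iteratedDeriv k u x ^ 2 ≤ 2 * (√(E k ω) * √(E (k + 1) ω)) := by
      refine h1.trans ?_
      have a1 := Real.sqrt_le_sqrt (E_hilbert hu hω h0u h0 H k)
      have a2 := Real.sqrt_le_sqrt (E_hilbert hu hω h0u h0 H (k + 1))
      have := mul_le_mul a1 a2 (Real.sqrt_nonneg _) (Real.sqrt_nonneg _)
      unfold E at this ⊢
      linarith
    rw [mul_pow, mul_pow, mul_assoc, sq (iteratedDeriv (m - k) ω x)]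
    gcongr
    exact mul_self_nonneg _
  have hc : Continuous (iteratedDeriv m (fun x => u x * ω x)) := by
    have : SP (fun x => u x * ω x) := ⟨hu.1.mul hω.1, hu.2.mul hω.2⟩
    exact (this.iter m).1.continuous
  unfold E at *
  refine (intervalIntegral.integral_mono_on (by positivity)
    (Continuous.intervalIntegrable (by fun_prop) _ _)
    (Continuous.intervalIntegrable (by fun_prop) _ _) hpt).trans ?_
  rw [intervalIntegral.integral_const_mul, intervalIntegral.integral_finsetSum
    (fun k _ => Continuous.intervalIntegrable (by fun_prop) _ _), mul_assoc, Finset.sum_mul]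
  gcongr with k hk
  rw [intervalIntegral.integral_const_mul, intervalIntegral.integral_const_mul]
  have := term_bound hω m k (by simpa [Nat.lt_succ_iff] using hk)
  have h5 := mul_le_mul_of_nonneg_left this (show 0 ≤ (m.choose k : ℝ) ^ 2 * 2 by positivity)
  unfold E at h5
  refine le_trans (le_of_eq ?_) h5
  ring
lemma sobIP_bound {f g : ℝ → ℝ} (hf : SP f) (hg : SP g) (m : ℕ) (hm : 1 ≤ m) :
    |sobIP (m : ℝ) f g| ≤ √(E m f) * √(E m g) := by
  have h1 := hasSum_E hf m (by omega)
  have h2 := hasSum_E hg m (by omega)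
  have h := cs_tsum (p := fun k : ℤ => (k:ℝ) ^ m * fc f k) (q := fun k : ℤ => (k:ℝ) ^ m * fc g k)
    (P := E m f) (Q := E m g) (by convert h1 using 2; ring) (by convert h2 using 2; ring)
  convert h using 2
  unfold sobIP
  congr 1
  ext k
  rw [abs_rpow_two]
  ring

/-- for `m ≥ 1` and smooth zero-mean `u, ω` with `u_x = H(ω)`,
`|⟨∂ₓω, uω⟩_{Ḣ^m}| ≤ C(m) ‖ω‖_{Ḣ^{m+1}}^{2−1/(2(m+1))} ‖ω‖_{L²}^{1+1/(2(m+1))}`. -/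
theorem advection_gn_estimate (m : ℕ) (hm : 1 ≤ m) :
    ∃ C : ℝ, 0 < C ∧ ∀ ω u : ℝ → ℝ,
      ContDiff ℝ (⊤ : ℕ∞) ω → ContDiff ℝ (⊤ : ℕ∞) u →
      Function.Periodic ω (2 * Real.pi) → Function.Periodic u (2 * Real.pi) →
      (∫ x in (0 : ℝ)..(2 * Real.pi), ω x) = 0 →
      (∫ x in (0 : ℝ)..(2 * Real.pi), u x) = 0 →
      IsHilbertPair ω (deriv u) →
      |sobIP (m : ℝ) (deriv ω) (fun x => u x * ω x)| ≤
        C * sobNorm ((m : ℝ) + 1) ω ^ ((2 : ℝ) - 1 / (2 * ((m : ℝ) + 1))) *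
          l2norm ω ^ ((1 : ℝ) + 1 / (2 * ((m : ℝ) + 1))) := by
  set K : ℝ := ((m:ℝ) + 1) * ∑ k ∈ Finset.range (m + 1), (m.choose k : ℝ) ^ 2 * 2 with hK
  have hK0 : 0 ≤ K := by positivity
  refine ⟨√K + 1, by positivity, ?_⟩
  intro ω u sω su pω pu zω zu H
  have hω : SP ω := ⟨sω, pω⟩
  have hu : SP u := ⟨su, pu⟩
  have hp : SP (fun x => u x * ω x) := ⟨hu.1.mul hω.1, hu.2.mul hω.2⟩
  have h1 := sobIP_bound hω.deriv hp m hm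
  have h2 := prod_bound hu hω zu zω H m
  have e1 : E m (deriv ω) = E (m + 1) ω := by
    unfold E; simp only [iteratedDeriv_succ']
  have e2 : sobNorm ((m : ℝ) + 1) ω = √(E (m + 1) ω) := by
    have := sobNorm_eq hω (m + 1) (by omega)
    push_cast at this
    exact this
  have e3 : l2norm ω = √(E 0 ω) := by simp [l2norm, E]
  rw [e2, e3]
  rw [e1] at h1
  have x0 := E_nonneg 0 ω
  have y0 := E_nonneg (m + 1) ω
  have h3 := Real.sqrt_le_sqrt h2
  rw [← hK] at h3
  clear_value K
  set x := E 0 ω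
  set y := E (m + 1) ω
  set q : ℝ := 1 / (2 * ((m : ℝ) + 1)) with hq
  have hq1 : q ≤ 1 := by
    rw [hq, div_le_one (by positivity)]
    have : (0:ℝ) ≤ m := by positivity
    linarith
  have hqq : √(K * (x ^ (1 + q) * y ^ (1 - q))) = √K * ((√x) ^ (1 + q) * (√y) ^ (1 - q)) := by
    rw [Real.sqrt_mul hK0, Real.sqrt_mul (Real.rpow_nonneg x0 _)]
    simp only [Real.sqrt_eq_rpow]
    rw [← Real.rpow_mul x0, ← Real.rpow_mul y0, ← Real.rpow_mul x0, ← Real.rpow_mul y0,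
      mul_comm (1 + q), mul_comm (1 - q)]
  rw [hqq] at h3
  have e4 : √y ^ ((2:ℝ) - q) = √y * √y ^ (1 - q) := by
    rw [show (2:ℝ) - q = 1 + (1 - q) by ring,
      Real.rpow_add_of_nonneg (Real.sqrt_nonneg _) (by norm_num) (by linarith), Real.rpow_one]
  rw [e4]
  refine h1.trans ((mul_le_mul_of_nonneg_left h3 (Real.sqrt_nonneg y)).trans ?_)
  have hnn : 0 ≤ √y * √y ^ (1 - q) * √x ^ (1 + q) := by positivity
  nlinarith
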